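/- arXiv:1906.08083 — 2 statements merged into one kernel-verified Lean document; each statement's English description precedes it below -/
import Mathlib

section
/- Let p and q be distinct odd primes with p dividing q − 1. Let g be an integer that is simultaneously a primitive root modulo p and modulo q², and let ĝ be a power of g with ψ(ĝ) ≡ p (mod pq). Then for every ℓ with 0 ≤ ℓ < q and every integer v with gcd(v, q) = 1: the number of elements u ∈ D_ℓ with u ≡ v (mod q²) equals p − 1 if v mod q² lies in the coset ĝ^ℓ·⟨g^q⟩ of the subgroup of (Z/q²Z)* generated by g^q, and equals 0 otherwise. -/
/-- Euler quotient modulo `p*q`: for `gcd(t, pq) = 1` it is the unique integer in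
`{0, ..., pq-1}` congruent to `(t^((p-1)(q-1)) - 1)/(pq)` modulo `pq`; it is `0` otherwise. -/
def eulerQuotient (p q t : ℕ) : ℕ :=
  if Nat.gcd t (p * q) = 1 then ((t ^ ((p - 1) * (q - 1)) - 1) / (p * q)) % (p * q) else 0

/-- The binary threshold sequence over `F₂`: `s t = 0` if `ψ(t)/(pq) < 1/2`, else `1`. -/
def binSeq (p q t : ℕ) : ZMod 2 :=
  if 2 * eulerQuotient p q t < p * q then 0 else 1

/-- `D ℓ = { t : 0 ≤ t < pq², gcd(t, pq) = 1, ψ(t) ≡ p·ℓ (mod pq) }`. -/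
def Dset (p q ℓ : ℕ) : Finset ℕ :=
  (Finset.range (p * q ^ 2)).filter
    (fun t => Nat.gcd t (p * q) = 1 ∧ eulerQuotient p q t ≡ p * ℓ [MOD p * q])

theorem pow_modEq_one_of_totient_dvd {t n E : ℕ} (h : Nat.Coprime t n) (hE : Nat.totient n ∣ E) :
    t ^ E ≡ 1 [MOD n] := by
  obtain ⟨k, rfl⟩ := hE
  simpa [pow_mul] using (Nat.ModEq.pow_totient h).pow k

theorem exists_pow_eq_one_add {p q t : ℕ} (hp : p.Prime) (hq : q.Prime) (hne : p ≠ q)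
    (hdvd : p ∣ q - 1) (ht : Nat.gcd t (p * q) = 1) :
    ∃ m, t ^ ((p - 1) * (q - 1)) = 1 + p ^ 2 * q * m := by
  have htp : Nat.Coprime t p := Nat.Coprime.coprime_mul_right_right ht
  have htq : Nat.Coprime t q := Nat.Coprime.coprime_mul_left_right ht
  have h1 : t ^ ((p - 1) * (q - 1)) ≡ 1 [MOD p ^ 2] := by
    refine pow_modEq_one_of_totient_dvd (htp.pow_right 2) ?_
    rw [Nat.totient_prime_pow hp (by norm_num)]
    simpa [mul_comm] using mul_dvd_mul_left (p - 1) hdvd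
  have h2 : t ^ ((p - 1) * (q - 1)) ≡ 1 [MOD q] := by
    refine pow_modEq_one_of_totient_dvd htq ?_
    rw [Nat.totient_prime hq]
    exact dvd_mul_left _ _
  have hc : Nat.Coprime (p ^ 2) q := ((Nat.coprime_primes hp hq).2 hne).pow_left 2
  have h3 := (Nat.modEq_and_modEq_iff_modEq_mul hc).1 ⟨h1, h2⟩
  have hpos : 1 ≤ t ^ ((p - 1) * (q - 1)) := by
    rcases Nat.eq_zero_or_pos t with rfl | h
    · simp [hp.ne_one] at ht
    · exact Nat.one_le_pow _ _ h
  obtain ⟨m, hm⟩ := (Nat.modEq_iff_dvd' hpos).1 h3.symm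
  exact ⟨m, by omega⟩

theorem eulerQuotient_modEq_iff {p q t : ℕ} (hp : p.Prime) (hq : q.Prime) (hne : p ≠ q)
    (hdvd : p ∣ q - 1) (ht : Nat.gcd t (p * q) = 1) (l : ℕ) :
    eulerQuotient p q t ≡ p * l [MOD p * q] ↔
      (t : ZMod (q ^ 2)) ^ ((p - 1) * (q - 1)) = 1 + (p : ZMod (q ^ 2)) ^ 2 * q * l := by
  obtain ⟨m, hm⟩ := exists_pow_eq_one_add hp hq hne hdvd ht
  have hc : Nat.gcd q (p ^ 2) = 1 := ((Nat.coprime_primes hq hp).2 hne.symm).pow_right 2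
  have hdiv : (t ^ ((p - 1) * (q - 1)) - 1) / (p * q) = p * m := by
    rw [hm, Nat.add_sub_cancel_left, show p ^ 2 * q * m = p * q * (p * m) by ring]
    exact Nat.mul_div_cancel_left _ (Nat.mul_pos hp.pos hq.pos)
  have hl : eulerQuotient p q t ≡ p * l [MOD p * q] ↔ m ≡ l [MOD q] := by
    rw [eulerQuotient, if_pos ht, hdiv]
    exact ⟨fun h => Nat.ModEq.mul_left_cancel' hp.ne_zero ((Nat.mod_modEq _ _).symm.trans h),
      fun h => (Nat.mod_modEq _ _).trans (h.mul_left' p)⟩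
  have hr : 1 + p ^ 2 * q * m ≡ 1 + p ^ 2 * q * l [MOD q ^ 2] ↔ m ≡ l [MOD q] := by
    rw [show p ^ 2 * q * m = q * (p ^ 2 * m) by ring, show p ^ 2 * q * l = q * (p ^ 2 * l) by ring,
      pow_two q]
    exact ⟨fun h => Nat.ModEq.cancel_left_of_coprime hc
        (Nat.ModEq.mul_left_cancel' hq.ne_zero (Nat.ModEq.add_left_cancel' 1 h)),
      fun h => ((h.mul_left (p ^ 2)).mul_left' q).add_left 1⟩
  rw [hl, ← hr, ← hm, ← ZMod.natCast_eq_natCast_iff]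
  push_cast
  rfl

theorem one_add_pow_of_sq_eq_zero {R : Type*} [CommRing R] {x : R} (hx : x ^ 2 = 0) (n : ℕ) :
    (1 + x) ^ n = 1 + x * n := by
  induction n with
  | zero => simp
  | succ k ih =>
    rw [pow_succ, ih]
    push_cast
    linear_combination (k : R) * hx

theorem pow_eq_one_iff_mem_powers_pow {G : Type*} [Group G] {g w : G} {q c : ℕ}
    (hq : q.Prime) (hcyc : ∀ x : G, x ∈ Submonoid.powers g) (hg : orderOf g = q * (q - 1))
    (hc : Nat.Coprime q c) :
    w ^ (c * (q - 1)) = 1 ↔ ∃ i : ℕ, w = (g ^ q) ^ i := by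
  have hpos : 0 < q - 1 := Nat.sub_pos_of_lt hq.one_lt
  constructor
  · intro h
    obtain ⟨a, rfl⟩ := hcyc w
    simp only [← pow_mul] at h
    have h1 := orderOf_dvd_of_pow_eq_one h
    rw [hg, ← mul_assoc] at h1
    obtain ⟨i, rfl⟩ := hc.dvd_of_dvd_mul_right (Nat.dvd_of_mul_dvd_mul_right hpos h1)
    exact ⟨i, by simp [pow_mul]⟩
  · rintro ⟨i, rfl⟩
    rw [← pow_mul, ← pow_mul, show q * (i * (c * (q - 1))) = q * (q - 1) * (i * c) by ring, ← hg,
      pow_mul, pow_orderOf_eq_one, one_pow]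

theorem card_filter_coprime_modEq {p n : ℕ} (hp : p.Prime) (hn : 0 < n) (hc : Nat.Coprime p n)
    (v : ℕ) :
    ((Finset.range (p * n)).filter (fun u => Nat.Coprime u p ∧ u ≡ v [MOD n])).card = p - 1 := by
  rw [← Nat.totient_prime hp, Nat.totient]
  refine Finset.card_nbij' (fun u => u % p) (fun a => (Nat.chineseRemainder hc a v : ℕ))
    ?_ ?_ ?_ ?_
  · intro u hu
    simp only [Finset.coe_filter, Finset.mem_range, Set.mem_ofPred_eq] at hu ⊢
    refine ⟨Nat.mod_lt _ hp.pos, ?_⟩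
    have := (Nat.mod_modEq u p).gcd_eq
    rw [Nat.coprime_comm, Nat.Coprime, this]
    exact hu.2.1
  · intro a ha
    simp only [Finset.coe_filter, Finset.mem_range, Set.mem_ofPred_eq] at ha ⊢
    have h := (Nat.chineseRemainder hc a v).2
    refine ⟨Nat.chineseRemainder_lt_mul hc a v hp.ne_zero hn.ne', ?_, h.2⟩
    rw [Nat.Coprime, h.1.gcd_eq]
    exact ha.2.symm
  · intro u hu
    simp only [Finset.coe_filter, Finset.mem_range, Set.mem_ofPred_eq] at hu
    have h := Nat.chineseRemainder_modEq_unique hc (Nat.mod_modEq u p).symm hu.2.2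
    exact (Nat.ModEq.eq_of_lt_of_lt h hu.1
      (Nat.chineseRemainder_lt_mul hc _ v hp.ne_zero hn.ne')).symm
  · intro a ha
    simp only [Finset.coe_filter, Finset.mem_range, Set.mem_ofPred_eq] at ha
    exact Nat.mod_eq_of_modEq (Nat.chineseRemainder hc a v).2.1 ha.1

theorem stmt_11 (p q : ℕ) (hp : p.Prime) (hq : q.Prime) (hpodd : Odd p) (hqodd : Odd q)
    (hne : p ≠ q) (hdvd : p ∣ q - 1) (g : ℕ)
    (hg1 : orderOf (g : ZMod p) = p - 1)
    (hg2 : orderOf (g : ZMod (q ^ 2)) = Nat.totient (q ^ 2))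
    (ghat : ℕ) (hghatpow : ∃ b : ℕ, (ghat : ZMod (p * q ^ 2)) = (g : ZMod (p * q ^ 2)) ^ b)
    (hghatcop : Nat.gcd ghat (p * q) = 1) (hghat : eulerQuotient p q ghat ≡ p [MOD p * q])
    (ℓ : ℕ) (hℓ : ℓ < q) (v : ℕ) (hv : Nat.gcd v q = 1) :
    ((∃ i : ℕ, (v : ZMod (q ^ 2)) =
        (ghat : ZMod (q ^ 2)) ^ ℓ * ((g : ZMod (q ^ 2)) ^ q) ^ i) →
      ((Dset p q ℓ).filter (fun u => u ≡ v [MOD q ^ 2])).card = p - 1) ∧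
    ((¬ ∃ i : ℕ, (v : ZMod (q ^ 2)) =
        (ghat : ZMod (q ^ 2)) ^ ℓ * ((g : ZMod (q ^ 2)) ^ q) ^ i) →
      ((Dset p q ℓ).filter (fun u => u ≡ v [MOD q ^ 2])).card = 0) := by
  have hcop : Nat.Coprime p q := (Nat.coprime_primes hp hq).2 hne
  have hc : Nat.Coprime q (p - 1) := by
    have h1 := Nat.le_of_dvd (Nat.sub_pos_of_lt hq.one_lt) hdvd
    have h2 := hp.one_lt
    have h3 : p - 1 ≠ 0 := by omega
    exact Nat.coprime_of_lt_prime h3 (by omega) hq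
  have hq2 : 0 < q ^ 2 := pow_pos hq.pos 2
  have : NeZero (q ^ 2) := ⟨hq2.ne'⟩
  have hord : Nat.totient (q ^ 2) = q * (q - 1) := by
    rw [Nat.totient_prime_pow hq two_pos]
    simp
  have hgcop : Nat.Coprime g (q ^ 2) := by
    rw [← ZMod.isUnit_iff_coprime]
    refine IsUnit.of_pow_eq_one (pow_orderOf_eq_one _) ?_
    rw [hg2]
    exact (Nat.totient_pos.2 hq2).ne'
  have hvq : Nat.Coprime v (q ^ 2) := Nat.Coprime.pow_right 2 hv
  have hhq : Nat.Coprime ghat (q ^ 2) :=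
    (Nat.Coprime.coprime_mul_left_right hghatcop).pow_right 2
  obtain ⟨G, hG⟩ : ∃ G : (ZMod (q ^ 2))ˣ, (G : ZMod (q ^ 2)) = g :=
    ⟨ZMod.unitOfCoprime g hgcop, rfl⟩
  obtain ⟨V, hV⟩ : ∃ V : (ZMod (q ^ 2))ˣ, (V : ZMod (q ^ 2)) = v :=
    ⟨ZMod.unitOfCoprime v hvq, rfl⟩
  obtain ⟨H, hH⟩ : ∃ H : (ZMod (q ^ 2))ˣ, (H : ZMod (q ^ 2)) = ghat :=
    ⟨ZMod.unitOfCoprime ghat hhq, rfl⟩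
  have hGord : orderOf G = Nat.totient (q ^ 2) := by rw [← orderOf_units, hG, hg2]
  have hcyc : ∀ x, x ∈ Submonoid.powers G := fun x => by
    have htop : Subgroup.zpowers G = ⊤ := Subgroup.eq_top_of_card_eq _ (by
      rw [Nat.card_zpowers, hGord, Nat.card_eq_fintype_card, ZMod.card_units_eq_totient])
    rw [mem_powers_iff_mem_zpowers, htop]
    exact Subgroup.mem_top x
  have hpow : (ghat : ZMod (q ^ 2)) ^ ((p - 1) * (q - 1)) = 1 + (p : ZMod (q ^ 2)) ^ 2 * q := by
    simpa using (eulerQuotient_modEq_iff hp hq hne hdvd hghatcop 1).1 (by simpa using hghat)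
  have hzero : ((p : ZMod (q ^ 2)) ^ 2 * q) ^ 2 = 0 := by
    have : (q : ZMod (q ^ 2)) ^ 2 = 0 := by
      rw [← Nat.cast_pow, ZMod.natCast_self]
    rw [mul_pow, this, mul_zero]
  have hcoset : (v : ZMod (q ^ 2)) ^ ((p - 1) * (q - 1)) = 1 + (p : ZMod (q ^ 2)) ^ 2 * q * ℓ ↔
      ∃ i : ℕ, (v : ZMod (q ^ 2)) =
        (ghat : ZMod (q ^ 2)) ^ ℓ * ((g : ZMod (q ^ 2)) ^ q) ^ i := by
    rw [← one_add_pow_of_sq_eq_zero hzero, ← hpow, ← hV, ← hH, ← hG, pow_right_comm]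
    have key := pow_eq_one_iff_mem_powers_pow (w := (H ^ ℓ)⁻¹ * V) hq hcyc (hGord.trans hord) hc
    rw [mul_pow, inv_pow, inv_mul_eq_one] at key
    simp only [inv_mul_eq_iff_eq_mul] at key
    norm_cast
    rw [eq_comm, key]
  have hmem : ∀ u, u ≡ v [MOD q ^ 2] → Nat.gcd u (p * q) = 1 →
      (eulerQuotient p q u ≡ p * ℓ [MOD p * q] ↔ ∃ i : ℕ, (v : ZMod (q ^ 2)) =
        (ghat : ZMod (q ^ 2)) ^ ℓ * ((g : ZMod (q ^ 2)) ^ q) ^ i) := by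
    intro u huv hu
    rw [eulerQuotient_modEq_iff hp hq hne hdvd hu, (ZMod.natCast_eq_natCast_iff _ _ _).2 huv, hcoset]
  constructor
  · intro h
    rw [← card_filter_coprime_modEq hp hq2 (hcop.pow_right 2) v]
    congr 1
    ext u
    simp only [Dset, Finset.mem_filter, Finset.mem_range]
    constructor
    · rintro ⟨⟨h1, h2, -⟩, h3⟩
      exact ⟨h1, Nat.Coprime.coprime_mul_right_right h2, h3⟩
    · rintro ⟨h1, h2, h3⟩
      have huq : Nat.Coprime u q := by
        rw [Nat.Coprime, (h3.of_dvd (dvd_pow_self q two_ne_zero)).gcd_eq, hv]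
      have hu : Nat.gcd u (p * q) = 1 := Nat.Coprime.mul_right h2 huq
      exact ⟨⟨h1, hu, (hmem u h3 hu).2 h⟩, h3⟩
  · intro h
    rw [Finset.card_eq_zero, Finset.filter_eq_empty_iff]
    intro u hu huv
    simp only [Dset, Finset.mem_filter] at hu
    exact h ((hmem u huv hu.2.1).1 hu.2.2)
end

section
/- Let p and q be distinct odd primes with p dividing q − 1. In the polynomial ring F₂[X], for every ℓ with 0 ≤ ℓ < q the polynomial D_ℓ(X) = Σ_{u ∈ D_ℓ} X^u satisfies D_ℓ(X) ≡ 1 (mod Φ_{pq}(X)) and D_ℓ(X) ≡ 0 (mod Φ_p(X)·Φ_q(X)·Φ_{q²}(X)), where Φ_n(X) denotes the n-th cyclotomic polynomial over F₂. -/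
open Polynomial

/-- Membership in `Dset p q ℓ`, with the Euler quotient condition expressed modulo `q ^ 2`. -/
lemma mem_Dset_iff {p q ℓ t : ℕ} (hp : p.Prime) (hq : q.Prime) (hne : p ≠ q)
    (hdvd : p ∣ q - 1) :
    t ∈ Dset p q ℓ ↔ t < p * q ^ 2 ∧ ¬ p ∣ t ∧ ¬ q ∣ t ∧
      t ^ ((p - 1) * (q - 1)) ≡ 1 + p * q * (p * ℓ) [MOD q ^ 2] := by
  have hpq : p.Coprime q := (Nat.coprime_primes hp hq).2 hne
  have hco : Nat.gcd t (p * q) = 1 ↔ ¬ p ∣ t ∧ ¬ q ∣ t := by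
    rw [← Nat.coprime_iff_gcd_eq_one, Nat.coprime_mul_iff_right, Nat.coprime_comm,
      hp.coprime_iff_not_dvd, Nat.coprime_comm, hq.coprime_iff_not_dvd]
  rw [Dset, Finset.mem_filter, Finset.mem_range, hco, and_assoc]
  refine and_congr_right fun _ => and_congr_right fun hpt => and_congr_right fun hqt => ?_
  have htpq : Nat.gcd t (p * q) = 1 := hco.2 ⟨hpt, hqt⟩
  have hcp : t.Coprime p := ((hp.coprime_iff_not_dvd).2 hpt).symm
  have hcq : t.Coprime q := ((hq.coprime_iff_not_dvd).2 hqt).symm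
  rw [eulerQuotient, if_pos htpq]
  set m := (p - 1) * (q - 1) with hm
  have hpos : 1 ≤ t ^ m := Nat.one_le_pow _ _ (Nat.pos_of_ne_zero (by rintro rfl; simp at hpt))
  have h_p2 : 1 ≡ t ^ m [MOD p ^ 2] := by
    obtain ⟨k, hk⟩ := hdvd
    have h := (Nat.ModEq.pow_totient (hcp.pow_right 2)).pow k
    rw [Nat.totient_prime_pow hp (by norm_num), one_pow, ← pow_mul] at h
    rw [hm, hk]
    convert h.symm using 2
    ring
  have h_q : 1 ≡ t ^ m [MOD q] := by
    have h := (Nat.ModEq.pow_totient hcq).pow (p - 1)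
    rw [Nat.totient_prime hq, one_pow, ← pow_mul, mul_comm (q - 1)] at h
    exact h.symm
  have hd2 : p ^ 2 ∣ t ^ m - 1 := (Nat.modEq_iff_dvd' hpos).1 h_p2
  have hdq : q ∣ t ^ m - 1 := (Nat.modEq_iff_dvd' hpos).1 h_q
  obtain ⟨w, hw⟩ : p * (p * q) ∣ t ^ m - 1 := by
    rw [← mul_assoc, ← pow_two]
    exact (hpq.pow_left 2).mul_dvd_of_dvd_of_dvd hd2 hdq
  have hw' : t ^ m - 1 = p * q * (p * w) := by rw [hw]; ring
  have ht : t ^ m = 1 + p * q * (p * w) := by omega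
  rw [hw', Nat.mul_div_cancel_left _ (Nat.mul_pos hp.pos hq.pos), ht]
  have h1 : p * w % (p * q) ≡ p * ℓ [MOD p * q] ↔ w ≡ ℓ [MOD q] := by
    rw [Nat.ModEq, Nat.mod_mod]
    exact Nat.ModEq.mul_left_cancel_iff' hp.ne_zero
  rw [h1]
  have e (a : ℕ) : p * q * (p * a) = q * (p ^ 2 * a) := by ring
  rw [e, e, pow_two q]
  constructor
  · intro h
    exact ((h.mul_left _).mul_left' q).add_left 1
  · intro h
    have h2 := Nat.ModEq.mul_left_cancel' hq.ne_zero (Nat.ModEq.add_left_cancel' 1 h)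
    exact Nat.ModEq.cancel_left_of_coprime ((hpq.pow_left 2).symm) h2

/-- Power roots lift from modulo `q` to modulo `q ^ 2` when the exponent is prime to `q`. -/
lemma exists_pow_modEq_sq {q m s c : ℕ} (hq : q.Prime) (hm : ¬ q ∣ m) (hs : ¬ q ∣ s)
    (h : s ^ m ≡ c [MOD q]) : ∃ k, (s + q * k) ^ m ≡ c [MOD q ^ 2] := by
  have := Fact.mk hq
  obtain ⟨d, hd⟩ := (Nat.modEq_iff_dvd).1 h
  have hm' : (m : ZMod q) ≠ 0 := by rwa [Ne, ZMod.natCast_eq_zero_iff]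
  have hs' : (s : ZMod q) ≠ 0 := by rwa [Ne, ZMod.natCast_eq_zero_iff]
  obtain ⟨k, hk⟩ := ZMod.natCast_zmod_surjective ((d : ZMod q) / ((m : ZMod q) * (s : ZMod q) ^ (m - 1)))
  refine ⟨k, ?_⟩
  rw [eq_div_iff (mul_ne_zero hm' (pow_ne_zero _ hs'))] at hk
  have hk' : (((k * (m * s ^ (m - 1)) : ℤ)) : ZMod q) = (d : ℤ) := by
    push_cast; exact hk
  obtain ⟨e, he⟩ := (Int.modEq_iff_dvd).1 ((ZMod.intCast_eq_intCast_iff _ _ q).1 hk')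
  obtain ⟨z, hz⟩ := Polynomial.powAddExpansion (s : ℤ) (q * k) m
  rw [Nat.modEq_iff_dvd]
  push_cast at hd ⊢
  refine ⟨e - z * k ^ 2, ?_⟩
  rw [hz]
  linear_combination hd + (q : ℤ) * he

/-- Power roots lift uniquely from modulo `q` to modulo `q ^ 2` when the exponent is prime
to `q`. -/
lemma modEq_sq_of_pow_modEq_sq {q m s t : ℕ} (hq : q.Prime) (hm : ¬ q ∣ m) (hs : ¬ q ∣ s)
    (h : s ≡ t [MOD q]) (hpow : s ^ m ≡ t ^ m [MOD q ^ 2]) : s ≡ t [MOD q ^ 2] := by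
  obtain ⟨k, hk⟩ := (Nat.modEq_iff_dvd).1 h
  obtain ⟨e, he⟩ := (Nat.modEq_iff_dvd).1 hpow
  obtain ⟨z, hz⟩ := Polynomial.powAddExpansion (s : ℤ) (q * k) m
  have ht : (t : ℤ) = s + q * k := by linarith
  have hq0 : (q : ℤ) ≠ 0 := by exact_mod_cast hq.ne_zero
  push_cast at he
  rw [ht, hz] at he
  have hdiv : (q : ℤ) ∣ m * s ^ (m - 1) * k :=
    ⟨e - z * k ^ 2, mul_left_cancel₀ hq0 (by linear_combination he)⟩
  have hq' : Prime (q : ℤ) := Nat.prime_iff_prime_int.1 hq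
  have hk' : (q : ℤ) ∣ k := by
    rcases hq'.dvd_or_dvd hdiv with h1 | h1
    · rcases hq'.dvd_or_dvd h1 with h2 | h2
      · exact absurd (Int.natCast_dvd_natCast.1 h2) hm
      · exact absurd (Int.natCast_dvd_natCast.1 (hq'.dvd_of_dvd_pow h2)) hs
    · exact h1
  rw [Nat.modEq_iff_dvd, hk]
  push_cast
  rw [pow_two]
  exact mul_dvd_mul_left _ hk'

/-- In characteristic two, a power sum over a set of exponents stable under negation modulo an
odd `P` vanishes at `Q`-th roots of unity. -/
lemma sum_pow_eq_zero_of_neg_stable {R : Type*} [CommRing R] [CharP R 2] {P Q : ℕ}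
    (hPQ : P.Coprime Q) (hP : Odd P) (hQ : Q ≠ 0) {S : Finset ℕ}
    (hlt : ∀ t ∈ S, t < P * Q) (hdvd : ∀ t ∈ S, ¬ P ∣ t)
    (hS : ∀ t ∈ S, ∀ t' < P * Q, P ∣ t' + t → t' ≡ t [MOD Q] → t' ∈ S)
    {x : R} (hx : x ^ Q = 1) : ∑ t ∈ S, x ^ t = 0 := by
  have hP0 : P ≠ 0 := hP.pos.ne'
  let g : ℕ → ℕ := fun t => Nat.chineseRemainder hPQ ((P - 1) * t) t
  have hg_lt (t : ℕ) : g t < P * Q := Nat.chineseRemainder_lt_mul hPQ _ _ hP0 hQ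
  have hgQ (t : ℕ) : g t ≡ t [MOD Q] := (Nat.chineseRemainder hPQ ((P - 1) * t) t).2.2
  have hgP (t : ℕ) : P ∣ g t + t := by
    have h : g t + t ≡ (P - 1) * t + t [MOD P] :=
      (Nat.chineseRemainder hPQ ((P - 1) * t) t).2.1.add_right t
    have h2 : (P - 1) * t + t = P * t := by
      rw [← Nat.succ_mul, Nat.succ_eq_add_one, Nat.sub_add_cancel hP.pos]
    rw [h2] at h
    exact (Nat.modEq_zero_iff_dvd).1 (h.trans (Nat.modEq_zero_iff_dvd.2 (dvd_mul_right _ _)))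
  refine Finset.sum_involution (fun t _ => g t) ?_ ?_ ?_ ?_
  · intro t _
    rw [pow_eq_pow_of_modEq (hgQ t) hx, CharTwo.add_self_eq_zero]
  · intro t ht _ heq
    have h := hgP t
    rw [heq, ← two_mul] at h
    exact hdvd t ht ((Nat.coprime_two_right.2 hP).dvd_of_dvd_mul_left h)
  · intro t ht
    exact hS t ht _ (hg_lt t) (hgP t) (hgQ t)
  · intro t ht
    refine Nat.ModEq.eq_of_lt_of_lt ?_ (hg_lt _) (hlt t ht)
    rw [← Nat.modEq_and_modEq_iff_modEq_mul hPQ]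
    refine ⟨?_, (hgQ _).trans (hgQ t)⟩
    have h1 := (Nat.modEq_zero_iff_dvd.2 (hgP (g t))).trans (Nat.modEq_zero_iff_dvd.2 (hgP t)).symm
    rw [add_comm (g t) t] at h1
    exact h1.add_right_cancel' (g t)

/-- `Σ_{0 ≤ j < b} X ^ (a j)` is divisible by the `ab`-th cyclotomic polynomial. -/
lemma cyclotomic_dvd_sum_pow_mul {R : Type*} [CommRing R] [IsDomain R] {a b : ℕ} (ha : 0 < a)
    (hb : 1 < b) : cyclotomic (a * b) R ∣ ∑ j ∈ Finset.range b, (X : R[X]) ^ (a * j) := by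
  have hmem : a ∈ (a * b).properDivisors :=
    Nat.mem_properDivisors.2 ⟨dvd_mul_right _ _, by nlinarith⟩
  have h := X_pow_sub_one_mul_cyclotomic_dvd_X_pow_sub_one_of_dvd R hmem
  have hgeom : (X ^ a - 1) * ∑ j ∈ Finset.range b, (X : R[X]) ^ (a * j) = X ^ (a * b) - 1 := by
    simp_rw [pow_mul]
    exact mul_geom_sum _ _
  rw [← hgeom] at h
  have h0 : (X : R[X]) ^ a - 1 ≠ 0 := by
    simpa using X_pow_sub_C_ne_zero (R := R) ha 1
  exact (mul_dvd_mul_iff_left h0).1 h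

/-- Every class prime to `p * q` has exactly one representative in `Dset p q ℓ`. -/
lemma existsUnique_mem_Dset_modEq {p q s : ℕ} (ℓ : ℕ) (hp : p.Prime) (hq : q.Prime)
    (hne : p ≠ q) (hdvd : p ∣ q - 1) (hps : ¬ p ∣ s) (hqs : ¬ q ∣ s) :
    ∃! t, t ∈ Dset p q ℓ ∧ t ≡ s [MOD p * q] := by
  have hpq : p.Coprime q := (Nat.coprime_primes hp hq).2 hne
  have hq2 := hq.two_le
  have hp2 := hp.two_le
  have hlt : p ≤ q - 1 := Nat.le_of_dvd (by omega) hdvd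
  have hm : ¬ q ∣ (p - 1) * (q - 1) := by
    rw [hq.dvd_mul]
    rintro (h | h) <;> have := Nat.le_of_dvd (by omega) h <;> omega
  have hpow : s ^ ((p - 1) * (q - 1)) ≡ 1 + p * q * (p * ℓ) [MOD q] := by
    have hcq : s.Coprime q := ((hq.coprime_iff_not_dvd).2 hqs).symm
    have h := (Nat.ModEq.pow_totient hcq).pow (p - 1)
    rw [Nat.totient_prime hq, one_pow, ← pow_mul, mul_comm (q - 1)] at h
    refine h.trans ?_
    have h0 : p * q * (p * ℓ) ≡ 0 [MOD q] :=
      Nat.modEq_zero_iff_dvd.2 (Dvd.intro_left p rfl |>.mul_right _)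
    exact (h0.add_left 1).symm
  obtain ⟨k, hk⟩ := exists_pow_modEq_sq hq hm hqs hpow
  have hco : p.Coprime (q ^ 2) := hpq.pow_right 2
  obtain ⟨t, ⟨htp, htq⟩, ht_lt⟩ :
      ∃ t, (t ≡ s [MOD p] ∧ t ≡ s + q * k [MOD q ^ 2]) ∧ t < p * q ^ 2 :=
    ⟨_, (Nat.chineseRemainder hco s (s + q * k)).2,
      Nat.chineseRemainder_lt_mul hco _ _ hp.ne_zero (pow_ne_zero _ hq.ne_zero)⟩
  have htq' : t ≡ s [MOD q] := by
    have h := htq.of_dvd (dvd_pow_self q two_ne_zero)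
    simpa [Nat.ModEq] using h
  refine ⟨t, ⟨(mem_Dset_iff hp hq hne hdvd).2 ⟨ht_lt, ?_, ?_, (htq.pow _).trans hk⟩,
    (Nat.modEq_and_modEq_iff_modEq_mul hpq).1 ⟨htp, htq'⟩⟩, ?_⟩
  · rwa [htp.dvd_iff dvd_rfl]
  · rwa [htq'.dvd_iff dvd_rfl]
  · rintro t' ⟨ht', hs'⟩
    obtain ⟨h1, h2⟩ := (Nat.modEq_and_modEq_iff_modEq_mul hpq).2 hs'
    obtain ⟨l1, _, l3, l4⟩ := (mem_Dset_iff hp hq hne hdvd).1 ht'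
    refine Nat.ModEq.eq_of_lt_of_lt ?_ l1 ht_lt
    refine (Nat.modEq_and_modEq_iff_modEq_mul hco).1 ⟨h1.trans htp.symm, ?_⟩
    exact modEq_sq_of_pow_modEq_sq hq hm l3 (h2.trans htq'.symm)
      (l4.trans ((htq.pow _).trans hk).symm)

/-- The exponents in `Dset p q ℓ` are, modulo `p * q`, the sums `q * a + p * b` with
`0 < a < p` and `0 < b < q`. -/
lemma sum_Dset_pow_eq_mul {R : Type*} [CommRing R] {p q : ℕ} (ℓ : ℕ) (hp : p.Prime)
    (hq : q.Prime) (hne : p ≠ q) (hdvd : p ∣ q - 1) {x : R} (hx : x ^ (p * q) = 1) :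
    ∑ t ∈ Dset p q ℓ, x ^ t =
      (∑ a ∈ Finset.Ico 1 p, x ^ (q * a)) * ∑ b ∈ Finset.Ico 1 q, x ^ (p * b) := by
  have hpq : p.Coprime q := (Nat.coprime_primes hp hq).2 hne
  have hnd {a n : ℕ} (ha : a ∈ Finset.Ico 1 n) : ¬ n ∣ a := fun h => by
    have := Nat.le_of_dvd (by grind) h
    grind
  have hrep (y : ℕ × ℕ) (hy : y ∈ Finset.Ico 1 p ×ˢ Finset.Ico 1 q) :
      ∃! t, t ∈ Dset p q ℓ ∧ t ≡ q * y.1 + p * y.2 [MOD p * q] := by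
    obtain ⟨h1, h2⟩ := Finset.mem_product.1 hy
    refine existsUnique_mem_Dset_modEq ℓ hp hq hne hdvd ?_ ?_
    · rw [← Nat.dvd_add_iff_left (dvd_mul_right p _)]
      exact fun h => hnd h1 (hpq.dvd_of_dvd_mul_left h)
    · rw [← Nat.dvd_add_iff_right (dvd_mul_right q _)]
      exact fun h => hnd h2 (hpq.symm.dvd_of_dvd_mul_left h)
  choose! i hi hiu using hrep
  rw [Finset.sum_mul_sum, ← Finset.sum_product']
  symm
  refine Finset.sum_bij (fun y _ => i y) (fun y hy => (hi y hy).1) ?_ ?_ ?_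
  · rintro ⟨a, b⟩ hy ⟨a', b'⟩ hy' h
    have h1 := (hi _ hy).2.symm.trans (h ▸ (hi _ hy').2)
    obtain ⟨ha, hb⟩ := Finset.mem_product.1 hy
    obtain ⟨ha', hb'⟩ := Finset.mem_product.1 hy'
    rw [Finset.mem_Ico] at ha hb ha' hb'
    obtain ⟨e1, e2⟩ := (Nat.modEq_and_modEq_iff_modEq_mul hpq).2 h1
    have e1' : q * a ≡ q * a' [MOD p] := by simpa [Nat.ModEq] using e1
    have e2' : p * b ≡ p * b' [MOD q] := by simpa [Nat.ModEq] using e2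
    have := (e1'.cancel_left_of_coprime hpq).eq_of_lt_of_lt ha.2 ha'.2
    have := (e2'.cancel_left_of_coprime hpq.symm).eq_of_lt_of_lt hb.2 hb'.2
    exact Prod.ext ‹a = a'› ‹b = b'›
  · intro t ht
    obtain ⟨-, hpt, hqt, -⟩ := (mem_Dset_iff hp hq hne hdvd).1 ht
    have hsol {n k : ℕ} (hn : n.Prime) (hkn : n.Coprime k) (hnt : ¬ n ∣ t) :
        ∃ a ∈ Finset.Ico 1 n, k * a ≡ t [MOD n] := by
      have := Fact.mk hn
      have hk : (k : ZMod n) ≠ 0 := by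
        rw [Ne, ZMod.natCast_eq_zero_iff]
        exact (hn.coprime_iff_not_dvd).1 hkn
      have ht0 : (t : ZMod n) ≠ 0 := by rwa [Ne, ZMod.natCast_eq_zero_iff]
      refine ⟨((t : ZMod n) / k).val, Finset.mem_Ico.2 ⟨?_, ZMod.val_lt _⟩, ?_⟩
      · rw [Nat.one_le_iff_ne_zero, Ne, ZMod.val_eq_zero]
        exact div_ne_zero ht0 hk
      · rw [← ZMod.natCast_eq_natCast_iff]
        push_cast
        rw [ZMod.natCast_zmod_val, mul_div_cancel₀ _ hk]
    obtain ⟨a, ha, ha'⟩ := hsol hp hpq hpt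
    obtain ⟨b, hb, hb'⟩ := hsol hq hpq.symm hqt
    have hab : (a, b) ∈ Finset.Ico 1 p ×ˢ Finset.Ico 1 q := Finset.mem_product.2 ⟨ha, hb⟩
    refine ⟨(a, b), hab, (hiu _ hab t ⟨ht, ?_⟩).symm⟩
    refine (Nat.modEq_and_modEq_iff_modEq_mul hpq).1 ⟨?_, ?_⟩
    · simpa [Nat.ModEq] using ha'.symm
    · simpa [Nat.ModEq] using hb'.symm
  · intro y hy
    rw [← pow_add]
    exact (pow_eq_pow_of_modEq (hi y hy).2 hx).symm

/-- `cyclotomic (a * b)` forces `Σ_{1 ≤ j < b} x ^ (a j) = -1` at its canonical root. -/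
lemma sum_Ico_root_cyclotomic_pow_mul {R : Type*} [CommRing R] [IsDomain R] {a b : ℕ}
    (ha : 0 < a) (hb : 1 < b) :
    ∑ j ∈ Finset.Ico 1 b, AdjoinRoot.root (cyclotomic (a * b) R) ^ (a * j) = -1 := by
  have h := AdjoinRoot.mk_eq_zero.2 (cyclotomic_dvd_sum_pow_mul (R := R) ha hb)
  rw [Finset.range_eq_Ico, Finset.sum_eq_sum_Ico_succ_bot (by omega)] at h
  simp only [map_add, map_sum, map_pow, AdjoinRoot.mk_X, mul_zero, pow_zero, zero_add] at h
  exact eq_neg_of_add_eq_zero_right h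

/-- The canonical root of `f ∣ X ^ n - 1` is an `n`-th root of unity. -/
lemma AdjoinRoot.root_pow_eq_one_of_dvd {R : Type*} [CommRing R] {f : R[X]} {n : ℕ}
    (h : f ∣ X ^ n - 1) : AdjoinRoot.root f ^ n = 1 := by
  have := AdjoinRoot.mk_eq_zero.2 h
  rw [map_sub, map_pow, AdjoinRoot.mk_X, map_one] at this
  exact sub_eq_zero.1 this

/-- A binary polynomial whose exponents are stable under negation modulo an odd `P` is divisible
by every divisor of `X ^ Q - 1`. -/
lemma dvd_sum_X_pow_of_neg_stable {P Q : ℕ} (hPQ : P.Coprime Q) (hP : Odd P) (hQ : Q ≠ 0)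
    {S : Finset ℕ} (hlt : ∀ t ∈ S, t < P * Q) (hdvd : ∀ t ∈ S, ¬ P ∣ t)
    (hS : ∀ t ∈ S, ∀ t' < P * Q, P ∣ t' + t → t' ≡ t [MOD Q] → t' ∈ S)
    {f : (ZMod 2)[X]} (hf : f ∣ X ^ Q - 1) : f ∣ ∑ t ∈ S, (X : (ZMod 2)[X]) ^ t := by
  refine hf.trans ?_
  have hdeg : ((X : (ZMod 2)[X]) ^ Q - 1).degree ≠ 0 := by
    have := degree_X_pow_sub_C (R := ZMod 2) (Nat.pos_of_ne_zero hQ) 1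
    rw [map_one] at this
    rw [this]
    exact_mod_cast hQ
  have : Nontrivial (AdjoinRoot ((X : (ZMod 2)[X]) ^ Q - 1)) :=
    AdjoinRoot.nontrivial _ hdeg
  have : CharP (AdjoinRoot ((X : (ZMod 2)[X]) ^ Q - 1)) 2 := charP_of_injective_algebraMap
    (algebraMap (ZMod 2) _).injective 2
  rw [← AdjoinRoot.mk_eq_zero, map_sum]
  simp only [map_pow, AdjoinRoot.mk_X]
  exact sum_pow_eq_zero_of_neg_stable hPQ hP hQ hlt hdvd hS
    (AdjoinRoot.root_pow_eq_one_of_dvd dvd_rfl)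

theorem stmt_13 (p q : ℕ) (hp : p.Prime) (hq : q.Prime) (hpodd : Odd p) (hqodd : Odd q)
    (hne : p ≠ q) (hdvd : p ∣ q - 1) (ℓ : ℕ) (hℓ : ℓ < q) :
    cyclotomic (p * q) (ZMod 2) ∣ ((∑ u ∈ Dset p q ℓ, (X : (ZMod 2)[X]) ^ u) - 1) ∧
    cyclotomic p (ZMod 2) * cyclotomic q (ZMod 2) * cyclotomic (q ^ 2) (ZMod 2) ∣
      (∑ u ∈ Dset p q ℓ, (X : (ZMod 2)[X]) ^ u) := by
  have hpq : p.Coprime q := (Nat.coprime_primes hp hq).2 hne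
  have hmem {t : ℕ} := mem_Dset_iff (t := t) (ℓ := ℓ) hp hq hne hdvd
  have hqq : q < q ^ 2 := by nlinarith [hq.two_le]
  have hp_ne : p ≠ q ^ 2 := fun h => by
    have := (hpq.pow_right 2)
    rw [← h, Nat.coprime_self] at this
    exact hp.one_lt.ne' this
  have hdisj : p ∉ ({q, q ^ 2} : Finset ℕ) := by simp [hne, hp_ne]
  have hprod : ∏ d ∈ ({q, q ^ 2} : Finset ℕ), cyclotomic d (ZMod 2) =
      cyclotomic q (ZMod 2) * cyclotomic (q ^ 2) (ZMod 2) := Finset.prod_pair hqq.ne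
  constructor
  · rw [← AdjoinRoot.mk_eq_zero, map_sub, map_sum, map_one]
    simp only [map_pow, AdjoinRoot.mk_X]
    rw [sum_Dset_pow_eq_mul ℓ hp hq hne hdvd
      (AdjoinRoot.root_pow_eq_one_of_dvd (cyclotomic.dvd_X_pow_sub_one _ _)),
      sum_Ico_root_cyclotomic_pow_mul hp.pos hq.one_lt, mul_comm p q,
      sum_Ico_root_cyclotomic_pow_mul hq.pos hp.one_lt]
    ring
  · have hcop : IsCoprime (cyclotomic p (ZMod 2))
        (cyclotomic q (ZMod 2) * cyclotomic (q ^ 2) (ZMod 2)) := by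
      have hn : ((p * q ^ 2 : ℕ) : ZMod 2) ≠ 0 := by
        rw [Ne, ZMod.natCast_eq_zero_iff, ← even_iff_two_dvd, Nat.not_even_iff_odd]
        exact hpodd.mul hqodd.pow
      have hsep : ((X : (ZMod 2)[X]) ^ (p * q ^ 2) - 1).Separable := by
        simpa using separable_X_pow_sub_C (1 : ZMod 2) hn one_ne_zero
      refine (hsep.of_dvd ?_).isCoprime
      rw [← hprod, ← Finset.prod_insert (f := fun d => cyclotomic d (ZMod 2)) hdisj,
        ← prod_cyclotomic_eq_X_pow_sub_one (Nat.mul_pos hp.pos (pow_pos hq.pos 2))]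
      refine Finset.prod_dvd_prod_of_subset _ _ _ fun d hd => ?_
      rw [Nat.mem_divisors]
      refine ⟨?_, Nat.mul_ne_zero hp.ne_zero (pow_ne_zero _ hq.ne_zero)⟩
      simp only [Finset.mem_insert, Finset.mem_singleton] at hd
      rcases hd with rfl | rfl | rfl
      · exact dvd_mul_right _ _
      · exact (dvd_pow_self _ two_ne_zero).mul_left _
      · exact dvd_mul_left _ _
    rw [mul_assoc]
    refine hcop.mul_dvd ?_ ?_
    · refine dvd_sum_X_pow_of_neg_stable (P := q ^ 2) (hpq.pow_right 2).symm hqodd.pow hp.ne_zero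
        (fun t ht => ?_) (fun t ht h => ?_) (fun t ht t' hlt h1 h2 => ?_)
        (cyclotomic.dvd_X_pow_sub_one _ _)
      · rw [mul_comm]
        exact (hmem.1 ht).1
      · exact (hmem.1 ht).2.2.1 ((dvd_pow_self q two_ne_zero).trans h)
      · obtain ⟨-, l2, l3, l4⟩ := hmem.1 ht
        refine hmem.2 ⟨by rwa [mul_comm], by rwa [h2.dvd_iff dvd_rfl], ?_, ?_⟩
        · exact fun h => l3 ((Nat.dvd_add_right h).1 ((dvd_pow_self q two_ne_zero).trans h1))
        · refine Nat.ModEq.trans ?_ l4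
          have hm : Even ((p - 1) * (q - 1)) := (hpodd.tsub_odd odd_one).mul_right _
          have h3 : (t : ℤ) ≡ -(t' : ℤ) [ZMOD ((q ^ 2 : ℕ) : ℤ)] := by
            rw [Int.modEq_comm, Int.modEq_iff_dvd]
            have := Int.natCast_dvd_natCast.2 h1
            simpa [add_comm] using this
          have h4 := h3.pow ((p - 1) * (q - 1))
          rw [hm.neg_pow] at h4
          exact_mod_cast h4.symm
    · refine dvd_sum_X_pow_of_neg_stable (P := p) (Q := q ^ 2) (hpq.pow_right 2) hpodd
        (pow_ne_zero _ hq.ne_zero) (fun t ht => (hmem.1 ht).1) (fun t ht => (hmem.1 ht).2.1)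
        (fun t ht t' hlt h1 h2 => ?_) ?_
      · obtain ⟨-, l2, l3, l4⟩ := hmem.1 ht
        refine hmem.2 ⟨hlt, fun h => l2 ((Nat.dvd_add_right h).1 h1), ?_, (h2.pow _).trans l4⟩
        rwa [h2.dvd_iff (dvd_pow_self q two_ne_zero)]
      · rw [← hprod, ← prod_cyclotomic_eq_X_pow_sub_one (pow_pos hq.pos 2)]
        refine Finset.prod_dvd_prod_of_subset _ _ _ fun d hd => ?_
        rw [Nat.mem_divisors]
        refine ⟨?_, pow_ne_zero _ hq.ne_zero⟩
        simp only [Finset.mem_insert, Finset.mem_singleton] at hd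
        rcases hd with rfl | rfl
        · exact dvd_pow_self _ two_ne_zero
        · exact dvd_rfl
end
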